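/- There exists ε₀ > 0, depending only on S and k, such that for every k-fission H of S within any ε ≤ ε₀ the following holds: for every halving edge {v,w} of S, the halving edges of H traversing the v-cluster and the w-cluster are exactly the halving edges of the 2k-point configuration consisting of the v-cluster together with the w-cluster (which is itself a set of 2k points in general position). -/

import Mathlib

noncomputable section

/-- The plane. -/
abbrev Pt : Type := EuclideanSpace ℝ (Fin 2)

/-- Signed determinant of the triple `(p, q, r)`: positive iff `r` lies on the left of
the directed line from `p` to `q`. -/
def det2 (p q r : Pt) : ℝ :=
  (q 0 - p 0) * (r 1 - p 1) - (q 1 - p 1) * (r 0 - p 0)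

/-- A finite set of points in the plane is in general position if no three of its
(distinct) points are collinear. -/
def GenPos (S : Finset Pt) : Prop :=
  ∀ p ∈ S, ∀ q ∈ S, ∀ r ∈ S, p ≠ q → p ≠ r → q ≠ r →
    ¬ Collinear ℝ ({p, q, r} : Set Pt)

/-- `{p, q}` is a halving edge of `S`: `p, q` are distinct points of `S` and the open
half-planes on the two sides of the line through `p` and `q` each contain exactly
`(|S| - 2)/2` points of `S`. -/
def HalvingEdge (S : Finset Pt) (p q : Pt) : Prop :=
  p ∈ S ∧ q ∈ S ∧ p ≠ q ∧
    {r ∈ (S : Set Pt) | 0 < det2 p q r}.ncard = (S.card - 2) / 2 ∧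
    {r ∈ (S : Set Pt) | det2 p q r < 0}.ncard = (S.card - 2) / 2

/-- The halving edges graph of `S` (as a graph on the whole plane; all vertices
outside `S` are isolated). -/
def halvingGraph (S : Finset Pt) : SimpleGraph Pt :=
  SimpleGraph.fromRel (HalvingEdge S)

/-- The number of halving edges of `S`. -/
def halvingEdgeCount (S : Finset Pt) : ℕ :=
  {e : Sym2 Pt | ∃ p q, e = s(p, q) ∧ HalvingEdge S p q}.ncard

/-- `H`, together with the cluster map `cl`, is a `k`-fission of `S` within `ε`:
`H` is a set of `k * |S|` points in general position partitioned into clusters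
`cl v` of `k` points, one for each `v ∈ S`, with each point of the `v`-cluster
within distance `ε` of `v`. -/
structure IsFission (S : Finset Pt) (k : ℕ) (ε : ℝ) (H : Finset Pt)
    (cl : Pt → Finset Pt) : Prop where
  genPos : GenPos H
  cluster_card : ∀ v ∈ S, (cl v).card = k
  disj : ∀ v ∈ S, ∀ w ∈ S, v ≠ w → Disjoint (cl v) (cl w)
  union_eq : (H : Set Pt) = ⋃ v ∈ S, (cl v : Set Pt)
  close : ∀ v ∈ S, ∀ x ∈ cl v, dist x v ≤ ε

/-- A fission is plain if no halving edge of `H` has both endpoints in the same cluster. -/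
def IsPlain (S : Finset Pt) (H : Finset Pt) (cl : Pt → Finset Pt) : Prop :=
  ∀ v ∈ S, ∀ p ∈ cl v, ∀ q ∈ cl v, ¬ HalvingEdge H p q


local instance : DecidableEq Pt := Classical.decEq _

open Filter Topology

lemma continuous_det2 : Continuous fun x : Pt × Pt × Pt => det2 x.1 x.2.1 x.2.2 := by
  unfold det2
  fun_prop

lemma det2_self_left (p q : Pt) : det2 p q p = 0 := by simp [det2]

lemma det2_self_right (p q : Pt) : det2 p q q = 0 := by
  simp only [det2]
  ring

lemma collinear_of_det2_eq_zero {p q r : Pt} (hpq : p ≠ q) (h : det2 p q r = 0) :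
    Collinear ℝ ({p, q, r} : Set Pt) := by
  have key : ∃ t : ℝ, r 0 = t * (q 0 - p 0) + p 0 ∧ r 1 = t * (q 1 - p 1) + p 1 := by
    unfold det2 at h
    by_cases h0 : q 0 - p 0 = 0
    · have h1 : q 1 - p 1 ≠ 0 := fun h1 => hpq <| by
        ext i
        fin_cases i
        · exact (sub_eq_zero.1 h0).symm
        · exact (sub_eq_zero.1 h1).symm
      have h2 : r 0 - p 0 = 0 := by
        rw [h0] at h
        simpa [h1] using h
      refine ⟨(r 1 - p 1) / (q 1 - p 1), ?_, ?_⟩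
      · rw [h0]; linarith
      · field_simp; ring
    · refine ⟨(r 0 - p 0) / (q 0 - p 0), ?_, ?_⟩
      · field_simp; ring
      · field_simp; linarith
  obtain ⟨t, ht0, ht1⟩ := key
  rw [collinear_iff_of_mem (p₀ := p) (by simp)]
  refine ⟨q - p, ?_⟩
  rintro x (rfl | rfl | rfl)
  · exact ⟨0, by simp⟩
  · exact ⟨1, by simp⟩
  · refine ⟨t, ?_⟩
    ext i
    fin_cases i
    · simpa using ht0
    · simpa using ht1

/-- Small perturbations of three points do not change a nonzero orientation. -/
lemma eventually_sign_det2_eq {a b c : Pt} (h : det2 a b c ≠ 0) :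
    ∀ᶠ δ : ℝ in 𝓝[>] 0, ∀ p q r : Pt, dist p a ≤ δ → dist q b ≤ δ → dist r c ≤ δ →
      SignType.sign (det2 p q r) = SignType.sign (det2 a b c) := by
  have hev : ∀ᶠ x : Pt × Pt × Pt in 𝓝 (a, b, c),
      SignType.sign (det2 x.1 x.2.1 x.2.2) = SignType.sign (det2 a b c) := by
    have hc := continuous_det2.tendsto (a, b, c)
    rcases lt_or_gt_of_ne h with h | h
    · filter_upwards [hc.eventually (gt_mem_nhds h)] with x hx
      rw [sign_neg hx, sign_neg h]
    · filter_upwards [hc.eventually (lt_mem_nhds h)] with x hx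
      rw [sign_pos hx, sign_pos h]
  obtain ⟨η, hη, hball⟩ := Metric.eventually_nhds_iff.1 hev
  filter_upwards [Ioo_mem_nhdsGT hη] with δ hδ p q r hp hq hr
  refine hball (y := (p, q, r)) ?_
  simp only [Prod.dist_eq, max_lt_iff]
  exact ⟨hp.trans_lt hδ.2, hq.trans_lt hδ.2, hr.trans_lt hδ.2⟩

/-- Perturbing the points of a finite set in general position by at most some `ε₀ > 0` preserves
the orientation of every triple. -/
lemma exists_sign_det2_eq (S : Finset Pt) (hS : GenPos S) :
    ∃ ε₀ > 0, ∀ a ∈ S, ∀ b ∈ S, ∀ c ∈ S, a ≠ b → a ≠ c → b ≠ c →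
      ∀ p q r : Pt, dist p a ≤ ε₀ → dist q b ≤ ε₀ → dist r c ≤ ε₀ →
        SignType.sign (det2 p q r) = SignType.sign (det2 a b c) := by
  have hev : ∀ᶠ δ : ℝ in 𝓝[>] 0, ∀ a ∈ S, ∀ b ∈ S, ∀ c ∈ S, a ≠ b → a ≠ c → b ≠ c →
      ∀ p q r : Pt, dist p a ≤ δ → dist q b ≤ δ → dist r c ≤ δ →
        SignType.sign (det2 p q r) = SignType.sign (det2 a b c) := by
    refine (eventually_all_finset S).2 fun a ha => (eventually_all_finset S).2 fun b hb =>
      (eventually_all_finset S).2 fun c hc => ?_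
    simp only [eventually_imp_distrib_left]
    intro hab hac hbc
    exact eventually_sign_det2_eq fun h =>
      hS a ha b hb c hc hab hac hbc (collinear_of_det2_eq_zero hab h)
  obtain ⟨δ, hδ, hpos⟩ := (hev.and self_mem_nhdsWithin).exists
  exact ⟨δ, hpos, hδ⟩

/-- Counting the points of a fission that satisfy a predicate constant on all clusters but two. -/
lemma IsFission.ncard_sep {S : Finset Pt} {k : ℕ} {ε : ℝ} {H : Finset Pt}
    {cl : Pt → Finset Pt} (hH : IsFission S k ε H cl) {v w : Pt} (hv : v ∈ S) (hw : w ∈ S)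
    (hvw : v ≠ w) (P Q : Pt → Prop) (hQv : ¬ Q v) (hQw : ¬ Q w)
    (hPQ : ∀ u ∈ S, u ≠ v → u ≠ w → ∀ x ∈ cl u, P x ↔ Q u) :
    {r ∈ (H : Set Pt) | P r}.ncard =
      {r ∈ ((cl v ∪ cl w : Finset Pt) : Set Pt) | P r}.ncard +
        k * {r ∈ (S : Set Pt) | Q r}.ncard := by
  classical
  have conv (T : Finset Pt) (R : Pt → Prop) :
      {r ∈ (T : Set Pt) | R r}.ncard = (T.filter R).card := by
    rw [← Set.ncard_coe_finset, Finset.coe_filter]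
    rfl
  have hHU : H = S.biUnion cl := by
    apply Finset.coe_injective
    rw [hH.union_eq, Finset.coe_biUnion]
    rfl
  have hdisj (R : Pt → Prop) (a b : Pt) (ha : a ∈ S) (hb : b ∈ S) (hab : a ≠ b) :
      Disjoint ((cl a).filter R) ((cl b).filter R) :=
    Finset.disjoint_filter_filter (hH.disj a ha b hb hab)
  rw [conv, conv, conv, hHU, Finset.filter_biUnion,
    Finset.card_biUnion fun a ha b hb hab => hdisj P a b ha hb hab, Finset.filter_union,
    Finset.card_union_of_disjoint (hdisj P v w hv hw hvw),
    ← Finset.add_sum_erase S _ hv,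
    ← Finset.add_sum_erase (S.erase v) _ (Finset.mem_erase.2 ⟨hvw.symm, hw⟩), ← add_assoc]
  congr 1
  have hfilter : S.filter Q = ((S.erase v).erase w).filter Q := by
    ext u
    simp only [Finset.mem_filter, Finset.mem_erase]
    constructor
    · rintro ⟨hu, hQ⟩
      exact ⟨⟨fun h => hQw (h ▸ hQ), fun h => hQv (h ▸ hQ), hu⟩, hQ⟩
    · rintro ⟨⟨-, -, hu⟩, hQ⟩
      exact ⟨hu, hQ⟩
  rw [hfilter, Finset.card_filter, Finset.mul_sum]
  refine Finset.sum_congr rfl fun u hu => ?_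
  simp only [Finset.mem_erase] at hu
  have hu' := hPQ u hu.2.2 hu.2.1 hu.1
  by_cases hQ : Q u
  · rw [Finset.filter_true_of_mem fun x hx => (hu' x hx).2 hQ, hH.cluster_card u hu.2.2]
    simp [hQ]
  · rw [Finset.filter_false_of_mem fun x hx => mt (hu' x hx).1 hQ]
    simp [hQ]

lemma IsFission.card_eq {S : Finset Pt} {k : ℕ} {ε : ℝ} {H : Finset Pt}
    {cl : Pt → Finset Pt} (hH : IsFission S k ε H cl) : H.card = k * S.card := by
  classical
  have hHU : H = S.biUnion cl := by
    apply Finset.coe_injective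
    rw [hH.union_eq, Finset.coe_biUnion]
    rfl
  rw [hHU, Finset.card_biUnion hH.disj, Finset.sum_congr rfl hH.cluster_card]
  simp [mul_comm]

lemma IsFission.cluster_subset {S : Finset Pt} {k : ℕ} {ε : ℝ} {H : Finset Pt}
    {cl : Pt → Finset Pt} (hH : IsFission S k ε H cl) {v : Pt} (hv : v ∈ S) : cl v ⊆ H := by
  rw [← Finset.coe_subset, hH.union_eq]
  exact Set.subset_biUnion_of_mem (u := fun u => (cl u : Set Pt)) hv

/-- A pair of points in the `v`- and `w`-clusters of a fission is halving for the fission iff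
it is halving for the union of the two clusters, when `{v, w}` is halving and the fission is
close enough to preserve orientations. -/
lemma IsFission.halvingEdge_iff {S : Finset Pt} (hcard : Even S.card) {k : ℕ} (hk : 1 ≤ k)
    {ε : ℝ} {H : Finset Pt} {cl : Pt → Finset Pt} (hH : IsFission S k ε H cl) {v w : Pt}
    (hvw : HalvingEdge S v w) {p q : Pt} (hp : p ∈ cl v) (hq : q ∈ cl w)
    (hsign : ∀ u ∈ S, u ≠ v → u ≠ w → ∀ x ∈ cl u,
      SignType.sign (det2 p q x) = SignType.sign (det2 v w u)) :
    HalvingEdge H p q ↔ HalvingEdge (cl v ∪ cl w) p q := by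
  obtain ⟨hv, hw, hne, hpos, hneg⟩ := hvw
  have cpos := hH.ncard_sep hv hw hne (fun r => 0 < det2 p q r) (fun r => 0 < det2 v w r)
    (by simp [det2_self_left]) (by simp [det2_self_right])
    fun u hu huv huw x hx => by
      rw [← sign_eq_one_iff, hsign u hu huv huw x hx, sign_eq_one_iff]
  have cneg := hH.ncard_sep hv hw hne (fun r => det2 p q r < 0) (fun r => det2 v w r < 0)
    (by simp [det2_self_left]) (by simp [det2_self_right])
    fun u hu huv huw x hx => by
      rw [← sign_eq_neg_one_iff, hsign u hu huv huw x hx, sign_eq_neg_one_iff]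
  have hunion : (cl v ∪ cl w).card = 2 * k := by
    rw [Finset.card_union_of_disjoint (hH.disj v hv w hw hne), hH.cluster_card v hv,
      hH.cluster_card w hw, two_mul]
  have hnum : (H.card - 2) / 2 = ((cl v ∪ cl w).card - 2) / 2 + k * ((S.card - 2) / 2) := by
    have hSpos : 0 < S.card := Finset.card_pos.2 ⟨v, hv⟩
    rw [hH.card_eq, hunion]
    obtain ⟨m, hm⟩ := hcard
    obtain ⟨j, rfl⟩ : ∃ j, m = j + 1 := ⟨m - 1, by omega⟩
    have h1 : (S.card - 2) / 2 = j := by omega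
    have h2 : k * S.card = 2 * (k * j) + 2 * k := by rw [hm]; ring
    rw [h1, h2]
    omega
  unfold HalvingEdge
  rw [cpos, cneg, hpos, hneg, hnum, Nat.add_right_cancel_iff, Nat.add_right_cancel_iff]
  simp [hH.cluster_subset hv hp, hH.cluster_subset hw hq, hp, hq]

theorem stmt6 (S : Finset Pt) (hS : GenPos S) (hcard : Even S.card)
    (k : ℕ) (hk : 1 ≤ k) :
    ∃ ε₀ > 0, ∀ ε : ℝ, 0 < ε → ε ≤ ε₀ →
      ∀ (H : Finset Pt) (cl : Pt → Finset Pt), IsFission S k ε H cl →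
        ∀ v ∈ S, ∀ w ∈ S, HalvingEdge S v w →
          GenPos (cl v ∪ cl w) ∧
          {e : Sym2 Pt | ∃ p ∈ cl v, ∃ q ∈ cl w, e = s(p, q) ∧ HalvingEdge H p q} =
            {e : Sym2 Pt | ∃ p ∈ cl v, ∃ q ∈ cl w, e = s(p, q) ∧
              HalvingEdge (cl v ∪ cl w) p q} := by
  obtain ⟨ε₀, hε₀, hsign⟩ := exists_sign_det2_eq S hS
  refine ⟨ε₀, hε₀, fun ε _ hε H cl hH v hv w hw hvw => ⟨?_, ?_⟩⟩
  · have hsub : cl v ∪ cl w ⊆ H :=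
      Finset.union_subset (hH.cluster_subset hv) (hH.cluster_subset hw)
    exact fun p hp q hq r hr => hH.genPos p (hsub hp) q (hsub hq) r (hsub hr)
  · have close {u x : Pt} (hu : u ∈ S) (hx : x ∈ cl u) : dist x u ≤ ε₀ :=
      (hH.close u hu x hx).trans hε
    have key {p q : Pt} (hp : p ∈ cl v) (hq : q ∈ cl w) :
        HalvingEdge H p q ↔ HalvingEdge (cl v ∪ cl w) p q :=
      hH.halvingEdge_iff hcard hk hvw hp hq fun u hu huv huw x hx =>
        hsign v hv w hw u hu hvw.2.2.1 huv.symm huw.symm p q x (close hv hp) (close hw hq)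
          (close hu hx)
    ext e
    constructor
    · rintro ⟨p, hp, q, hq, he, h⟩
      exact ⟨p, hp, q, hq, he, (key hp hq).1 h⟩
    · rintro ⟨p, hp, q, hq, he, h⟩
      exact ⟨p, hp, q, hq, he, (key hp hq).2 h⟩

end
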